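/- arXiv:2202.10611 — 2 statements merged into one kernel-verified Lean document; each statement's English description precedes it below -/
import Mathlib

section
/- Fix ε ∈ (0, 2/3). There exists a constant c > 0 such that for all sufficiently large n and k with k ≤ n^(2/3 − ε), all R with 1 ≤ R ≤ min(n^(0.5ε), k^(0.5 − ε)), and all m with m < c·R·(k/log k)^(3/2)·min(R², (log k)²), the following holds: if A ∈ ℝ^(m×n) is a random matrix whose entries are i.i.d. standard Gaussian N(0,1) random variables, then with probability at least 1/3, A is not a valid universal 1-bit measurement matrix for support recovery on X_k(R). -/
open MeasureTheory ProbabilityTheory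
open scoped NNReal ENNReal

/-- The sign function: `1` if `0 ≤ z`, `-1` otherwise. -/
noncomputable def sgn (z : ℝ) : ℝ := if 0 ≤ z then 1 else -1

/-- `X_k(R)`: vectors in `ℝ^n` with at most `k` nonzero entries whose nonzero
entries have magnitude ratio at most `R`. -/
def sparseDR (n k : ℕ) (R : ℝ) : Set (Fin n → ℝ) :=
  {x | (Finset.univ.filter fun i => x i ≠ 0).card ≤ k ∧
       ∀ i j : Fin n, x i ≠ 0 → x j ≠ 0 → |x i| ≤ R * |x j|}

/-- `A` is a valid universal 1-bit measurement matrix for support recovery on `X_k(R)`. -/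
def ValidMeas (m n k : ℕ) (R : ℝ) (A : Fin m → Fin n → ℝ) : Prop :=
  ∀ u ∈ sparseDR n k R, ∀ v ∈ sparseDR n k R,
    Function.support u ≠ Function.support v →
      (fun i => sgn (∑ j, A i j * u j)) ≠ (fun i => sgn (∑ j, A i j * v j))

/-- `V ⊆ ℝ^n` is `(n, ℓ, d)`-balanced. -/
def IsBalanced (n ℓ : ℕ) (d : ℝ) (V : Set (Fin n → ℝ)) : Prop :=
  ∀ S : Finset (Fin n), S.card = ℓ → ∃ v ∈ V, |∑ i ∈ S, v i| ≤ d

/-- Law of a random vector in `ℝ^n` with i.i.d. standard Gaussian entries. -/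
noncomputable def gaussVec (n : ℕ) : Measure (Fin n → ℝ) :=
  Measure.pi fun _ => gaussianReal 0 1

/-- Law of `m` independent random vectors in `ℝ^n` with i.i.d. standard Gaussian entries
(equivalently, an `m × n` random matrix with i.i.d. `N(0,1)` entries). -/
noncomputable def gaussMat (m n : ℕ) : Measure (Fin m → Fin n → ℝ) :=
  Measure.pi fun _ => gaussVec n

/-- The event `F_U`: every one of the `m` vectors `v j` satisfies `|∑_{i ∈ U} (v j) i| > d`. -/
def FEvent (m n : ℕ) (d : ℝ) (U : Finset (Fin n)) : Set (Fin m → Fin n → ℝ) :=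
  {v | ∀ j : Fin m, d < |∑ i ∈ U, v j i|}

instance (n : ℕ) : IsProbabilityMeasure (gaussVec n) := by
  unfold gaussVec; infer_instance

instance (m n : ℕ) : IsProbabilityMeasure (gaussMat m n) := by
  unfold gaussMat; infer_instance

lemma gaussianPDFReal_zero_mean_le (v : ℝ≥0) (x : ℝ) :
    gaussianPDFReal 0 v x ≤ (√(2 * Real.pi * v))⁻¹ := by
  rw [gaussianPDFReal]
  refine mul_le_of_le_one_right (by positivity) (Real.exp_le_one_iff.2 ?_)
  rw [neg_div]
  exact neg_nonpos.2 (by positivity)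

lemma le_gaussianPDFReal_zero_mean (v : ℝ≥0) {x d : ℝ} (hx : |x| ≤ d) :
    Real.exp (-(d ^ 2 / (2 * v))) * (√(2 * Real.pi * v))⁻¹ ≤ gaussianPDFReal 0 v x := by
  rw [gaussianPDFReal, mul_comm, sub_zero, neg_div]
  have : x ^ 2 ≤ d ^ 2 := by rw [← sq_abs x]; gcongr
  gcongr

lemma setOf_abs_add_le_eq_Icc (u d : ℝ) :
    {y : ℝ | |u + y| ≤ d} = Set.Icc (-u - d) (-u + d) := by
  ext y
  simp only [Set.mem_ofPred_eq, Set.mem_Icc, abs_le]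
  constructor <;> rintro ⟨h1, h2⟩ <;> constructor <;> linarith

/-- Small-ball upper bound for a centred Gaussian. -/
lemma gaussianReal_real_abs_add_le {v : ℝ≥0} (hv : v ≠ 0) (u : ℝ) {d : ℝ} (hd : 0 ≤ d) :
    (gaussianReal 0 v).real {y | |u + y| ≤ d} ≤ 2 * d / √(2 * Real.pi * v) := by
  rw [measureReal_def, gaussianReal_apply_eq_integral 0 hv,
    ENNReal.toReal_ofReal (integral_nonneg fun x => gaussianPDFReal_nonneg _ _ _),
    setOf_abs_add_le_eq_Icc]
  calc ∫ x in Set.Icc (-u - d) (-u + d), gaussianPDFReal 0 v x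
      ≤ ∫ x in Set.Icc (-u - d) (-u + d), (√(2 * Real.pi * v))⁻¹ :=
        setIntegral_mono (integrable_gaussianPDFReal 0 v).integrableOn
          (integrable_const _) fun x => gaussianPDFReal_zero_mean_le v x
    _ = 2 * d / √(2 * Real.pi * v) := by
        simp only [integral_const, MeasurableSet.univ, measureReal_restrict_apply, Set.univ_inter,
          smul_eq_mul, Real.volume_real_Icc]
        rw [max_eq_left (by linarith)]; ring

/-- Small-ball lower bound for a centred Gaussian. -/
lemma le_gaussianReal_real_abs_le {v : ℝ≥0} (hv : v ≠ 0) {d : ℝ} (hd : 0 ≤ d) :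
    Real.exp (-(d ^ 2 / (2 * v))) * (2 * d / √(2 * Real.pi * v)) ≤
      (gaussianReal 0 v).real {y | |y| ≤ d} := by
  have hI : {y : ℝ | |y| ≤ d} = Set.Icc (-d) d := by
    ext y; simp [abs_le]
  rw [measureReal_def, gaussianReal_apply_eq_integral 0 hv,
    ENNReal.toReal_ofReal (integral_nonneg fun x => gaussianPDFReal_nonneg _ _ _), hI]
  calc Real.exp (-(d ^ 2 / (2 * v))) * (2 * d / √(2 * Real.pi * v))
      = ∫ x in Set.Icc (-d) d, Real.exp (-(d ^ 2 / (2 * v))) * (√(2 * Real.pi * v))⁻¹ := by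
        simp only [integral_const, MeasurableSet.univ, measureReal_restrict_apply, Set.univ_inter,
          smul_eq_mul, Real.volume_real_Icc]
        rw [max_eq_left (by linarith)]; ring
    _ ≤ ∫ x in Set.Icc (-d) d, gaussianPDFReal 0 v x := by
        refine setIntegral_mono_on (integrable_const _)
          (integrable_gaussianPDFReal 0 v).integrableOn measurableSet_Icc fun x hx => ?_
        exact le_gaussianPDFReal_zero_mean v (abs_le.2 hx)

lemma gaussianReal_real_lt_abs_le {D : ℝ} (hD : 0 ≤ D) :
    (gaussianReal 0 1).real {y | D < |y|} ≤ 2 * Real.exp (-(D ^ 2 / 2)) := by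
  have tail : ∀ X : ℝ → ℝ, Measurable X → (gaussianReal 0 1).map X = gaussianReal 0 1 →
      (gaussianReal 0 1).real {y | D ≤ X y} ≤ Real.exp (-(D ^ 2 / 2)) := by
    intro X hX hmap
    have hint : Integrable (fun y => Real.exp (D * X y)) (gaussianReal 0 1) := by
      have := integrable_exp_mul_gaussianReal (μ := 0) (v := 1) D
      rw [← hmap] at this
      exact this.comp_measurable hX
    refine (measure_ge_le_exp_mul_mgf D hD hint).trans (le_of_eq ?_)
    rw [mgf_gaussianReal hmap, ← Real.exp_add]
    congr 1
    simp; ring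
  have h1 := tail id measurable_id (by simp)
  have h2 := tail (fun y => -y) measurable_neg
    (by simpa using gaussianReal_map_neg (μ := 0) (v := 1))
  calc (gaussianReal 0 1).real {y | D < |y|}
      ≤ (gaussianReal 0 1).real ({y | D ≤ id y} ∪ {y | D ≤ -y}) := by
        refine measureReal_mono fun y hy => ?_
        rcases lt_abs.1 (Set.mem_ofPred.1 hy) with h | h
        · exact Or.inl h.le
        · exact Or.inr h.le
    _ ≤ _ := (measureReal_union_le _ _).trans (by linarith)

lemma iIndepFun_eval_gaussVec (n : ℕ) :
    iIndepFun (fun (i : Fin n) (v : Fin n → ℝ) => v i) (gaussVec n) :=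
  iIndepFun_pi (X := fun _ => id) fun _ => aemeasurable_id

lemma map_eval_gaussVec {n : ℕ} (i : Fin n) :
    (gaussVec n).map (fun v => v i) = gaussianReal 0 1 :=
  (measurePreserving_eval (fun _ : Fin n => gaussianReal 0 1) i).map_eq

lemma map_sum_gaussVec {n : ℕ} (S : Finset (Fin n)) :
    (gaussVec n).map (fun v => ∑ i ∈ S, v i) = gaussianReal 0 (S.card : ℝ≥0) := by
  induction S using Finset.induction_on with
  | empty => simp [Measure.map_const, gaussianReal_zero_var]
  | insert a S ha ih =>
    have hind := (iIndepFun_eval_gaussVec n).indepFun_finsetSum_of_notMem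
      (fun i => measurable_pi_apply i) ha
    have h := gaussianReal_add_gaussianReal_of_indepFun hind.symm (map_eval_gaussVec a)
      (by simpa [Finset.sum_fn] using ih)
    simp only [Finset.sum_insert ha, Finset.card_insert_of_notMem ha]
    convert h using 2
    · ext v; simp
    · simp
    · push_cast; ring

/-- Conditionally on the coordinates in `S`, the sum over `T` has a Gaussian component of variance
`#(T \ S)`, so it lands in `[-d, d]` with probability controlled by the small-ball bound. -/
lemma gaussVec_real_inter_le {n : ℕ} (S T : Finset (Fin n)) (hTS : (T \ S).card ≠ 0) {d : ℝ}
    (hd : 0 ≤ d) :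
    (gaussVec n).real ({v | |∑ i ∈ S, v i| ≤ d} ∩ {v | |∑ i ∈ T, v i| ≤ d}) ≤
      2 * d / √(2 * Real.pi * (T \ S).card) * (gaussVec n).real {v | |∑ i ∈ S, v i| ≤ d} := by
  set g := 2 * d / √(2 * Real.pi * (T \ S).card)
  have hg : 0 ≤ g := by positivity
  let X : (Fin n → ℝ) → ℝ × ℝ := fun v => (∑ i ∈ S, v i, ∑ i ∈ T ∩ S, v i)
  let Y : (Fin n → ℝ) → ℝ := fun v => ∑ i ∈ T \ S, v i
  have hX : Measurable X := by fun_prop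
  have hY : Measurable Y := by fun_prop
  have hind : IndepFun X Y (gaussVec n) := by
    have h := (iIndepFun_eval_gaussVec n).indepFun_finset S (T \ S) Finset.disjoint_sdiff
      fun i => measurable_pi_apply i
    have hφ : Measurable fun w : S → ℝ =>
        (∑ i, w i, ∑ i ∈ Finset.univ.filter (fun i : S => (i : Fin n) ∈ T), w i) := by fun_prop
    have hψ : Measurable fun w : (T \ S : Finset (Fin n)) → ℝ => ∑ i, w i := by fun_prop
    have h' := h.comp hφ hψ
    convert h' using 1
    · ext v
      · exact (Finset.sum_coe_sort S v).symm
      · simp only [X, Function.comp]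
        rw [Finset.sum_filter, Finset.sum_coe_sort S (fun i => if i ∈ T then v i else 0),
          ← Finset.sum_filter, Finset.filter_mem_eq_inter, Finset.inter_comm]
    · ext v
      simp only [Y, Function.comp]
      rw [Finset.sum_coe_sort (T \ S) v]
  have hlaw := (indepFun_iff_map_prod_eq_prod_map_map hX.aemeasurable hY.aemeasurable).1 hind
  have hEm : MeasurableSet {z : (ℝ × ℝ) × ℝ | |z.1.1| ≤ d ∧ |z.1.2 + z.2| ≤ d} := by
    measurability
  have hpre : {v : Fin n → ℝ | |∑ i ∈ S, v i| ≤ d} ∩ {v | |∑ i ∈ T, v i| ≤ d} =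
      (fun v => (X v, Y v)) ⁻¹' {z | |z.1.1| ≤ d ∧ |z.1.2 + z.2| ≤ d} := by
    ext v
    simp only [X, Y, Set.mem_inter_iff, Set.mem_ofPred_eq, Set.mem_preimage,
      Finset.sum_inter_add_sum_sdiff]
  have hAm : MeasurableSet {x : ℝ × ℝ | |x.1| ≤ d} :=
    measurableSet_le (by fun_prop) measurable_const
  have key : gaussVec n ({v | |∑ i ∈ S, v i| ≤ d} ∩ {v | |∑ i ∈ T, v i| ≤ d}) ≤
      ENNReal.ofReal g * gaussVec n {v | |∑ i ∈ S, v i| ≤ d} := by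
    rw [hpre, ← Measure.map_apply (hX.prodMk hY) hEm, hlaw, Measure.prod_apply hEm]
    calc ∫⁻ x, (Measure.map Y (gaussVec n))
            (Prod.mk x ⁻¹' {z : (ℝ × ℝ) × ℝ | |z.1.1| ≤ d ∧ |z.1.2 + z.2| ≤ d})
            ∂(Measure.map X (gaussVec n))
        ≤ ∫⁻ x, Set.indicator {x : ℝ × ℝ | |x.1| ≤ d} (fun _ => ENNReal.ofReal g) x
            ∂(Measure.map X (gaussVec n)) := by
          refine lintegral_mono fun x => ?_
          by_cases hx : |x.1| ≤ d
          · rw [Set.indicator_of_mem (by exact hx)]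
            have : Prod.mk x ⁻¹' {z : (ℝ × ℝ) × ℝ | |z.1.1| ≤ d ∧ |z.1.2 + z.2| ≤ d} =
                {y | |x.2 + y| ≤ d} := by ext y; simp [hx]
            rw [this, map_sum_gaussVec, ← ofReal_measureReal]
            have hball := gaussianReal_real_abs_add_le
              (v := ((T \ S).card : ℝ≥0)) (by exact_mod_cast hTS) x.2 hd
            exact ENNReal.ofReal_le_ofReal (by simpa [g] using hball)
          · have : Prod.mk x ⁻¹' {z : (ℝ × ℝ) × ℝ | |z.1.1| ≤ d ∧ |z.1.2 + z.2| ≤ d} = ∅ := by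
              ext y; simp [hx]
            simp [this]
      _ = ENNReal.ofReal g * gaussVec n {v | |∑ i ∈ S, v i| ≤ d} := by
          rw [lintegral_indicator hAm, setLIntegral_const, Measure.map_apply hX hAm]
          rfl
  have := ENNReal.toReal_mono (by finiteness) key
  rwa [ENNReal.toReal_mul, ENNReal.toReal_ofReal hg] at this

/-- Second moment method for a finite family of equiprobable events. -/
lemma one_sub_le_measureReal_iUnion {Ω α : Type*} [MeasurableSpace Ω] {μ : Measure Ω}
    [IsProbabilityMeasure μ] [Fintype α] [Nonempty α] {F : α → Set Ω}
    (hF : ∀ a, MeasurableSet (F a)) {r δ : ℝ} (hr : 0 < r) (hFr : ∀ a, μ.real (F a) = r)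
    (h : ∑ a, ∑ b, μ.real (F a ∩ F b) ≤ (1 + δ) * (Fintype.card α * r) ^ 2) :
    1 - δ ≤ μ.real (⋃ a, F a) := by
  classical
  set c : ℝ := Fintype.card α * r
  have hc : 0 < c := mul_pos (by exact_mod_cast Fintype.card_pos) hr
  have hU : MeasurableSet (⋃ a, F a) := MeasurableSet.iUnion hF
  have hint : ∀ s : Set Ω, MeasurableSet s → Integrable (s.indicator (1 : Ω → ℝ)) μ :=
    fun s hs => (integrable_const (1 : ℝ)).indicator hs
  let X : Ω → ℝ := fun ω => ∑ a, (F a).indicator 1 ω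
  have hXint : Integrable X μ := integrable_finsetSum _ fun a _ => hint _ (hF a)
  have hX : ∫ ω, X ω ∂μ = c := by
    rw [integral_finsetSum _ fun a _ => hint _ (hF a)]
    simp [integral_indicator_one, hF, hFr, c]
  have hXsq : ∀ ω, X ω ^ 2 = ∑ a, ∑ b, (F a ∩ F b).indicator 1 ω := by
    intro ω
    rw [sq, Finset.sum_mul_sum]
    refine Finset.sum_congr rfl fun a _ => Finset.sum_congr rfl fun b _ => ?_
    rw [Set.inter_indicator_one]; rfl
  have hX2int : Integrable (fun ω => X ω ^ 2) μ := by
    simp_rw [hXsq]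
    exact integrable_finsetSum _ fun a _ => integrable_finsetSum _ fun b _ =>
      hint _ ((hF a).inter (hF b))
  have hX2 : ∫ ω, X ω ^ 2 ∂μ = ∑ a, ∑ b, μ.real (F a ∩ F b) := by
    simp_rw [hXsq]
    rw [integral_finsetSum _ fun a _ => integrable_finsetSum _ fun b _ =>
      hint _ ((hF a).inter (hF b))]
    refine Finset.sum_congr rfl fun a _ => ?_
    rw [integral_finsetSum _ fun b _ => hint _ ((hF a).inter (hF b))]
    exact Finset.sum_congr rfl fun b _ => integral_indicator_one ((hF a).inter (hF b))
  have hle : ∫ ω, (⋃ a, F a)ᶜ.indicator 1 ω * c ^ 2 ∂μ ≤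
      ∫ ω, (X ω ^ 2 - 2 * c * X ω + c ^ 2) ∂μ := by
    refine integral_mono ((hint _ hU.compl).mul_const _)
      ((hX2int.sub (hXint.const_mul _)).add (integrable_const _)) fun ω => ?_
    by_cases hω : ω ∈ ⋃ a, F a
    · simp only [Set.indicator_of_notMem (Set.notMem_compl_iff.2 hω), zero_mul]
      nlinarith [sq_nonneg (X ω - c)]
    · have : X ω = 0 := Finset.sum_eq_zero fun a _ =>
        Set.indicator_of_notMem (fun ha => hω (Set.mem_iUnion.2 ⟨a, ha⟩)) _
      rw [Set.indicator_of_mem (Set.mem_compl hω), this]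
      simp
  have hvar : ∫ ω, (X ω ^ 2 - 2 * c * X ω + c ^ 2) ∂μ =
      ∑ a, ∑ b, μ.real (F a ∩ F b) - 2 * c * c + c ^ 2 := by
    rw [integral_add (f := fun ω => X ω ^ 2 - 2 * c * X ω) (g := fun _ => c ^ 2)
      (hX2int.sub (hXint.const_mul _)) (integrable_const _),
      integral_sub hX2int (hXint.const_mul _), integral_const_mul, hX, hX2]
    simp
  rw [integral_mul_const, integral_indicator_one hU.compl, hvar,
    probReal_compl_eq_one_sub hU] at hle
  have : (1 - μ.real (⋃ a, F a)) * c ^ 2 ≤ δ * c ^ 2 := by nlinarith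
  linarith [le_of_mul_le_mul_right this (by positivity)]

/-- Generating function of the number of agreements with a fixed function. -/
lemma sum_pow_card_agree {α β : Type*} [Fintype α] [DecidableEq α] [Fintype β] [DecidableEq β]
    (f : α → β) (x : ℝ) :
    ∑ g : α → β, x ^ (Finset.univ.filter fun a => f a = g a).card =
      (Fintype.card β - 1 + x) ^ Fintype.card α := by
  have h1 : ∀ g : α → β, x ^ (Finset.univ.filter fun a => f a = g a).card =
      ∏ a, if f a = g a then x else 1 := by
    intro g
    rw [← Finset.prod_filter, Finset.prod_const]
  have h2 : ∀ a, ∑ b : β, (if f a = b then x else 1) = Fintype.card β - 1 + x := by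
    intro a
    have : ∀ b : β, (if f a = b then x else (1 : ℝ)) = 1 + if f a = b then x - 1 else 0 := by
      intro b; split_ifs <;> ring
    simp_rw [this, Finset.sum_add_distrib, Finset.sum_ite_eq]
    simp; ring
  simp_rw [h1]
  rw [← Fintype.piFinset_univ, ← Finset.prod_univ_sum (fun _ => (Finset.univ : Finset β))
    (fun a b => if f a = b then x else (1 : ℝ))]
  simp_rw [h2]
  simp

/-- The injection of rows into `Fin n` that picks the entry `f b` in row `b` of the array `e`. -/
def transversalEmb {n K B : ℕ} (e : Fin K × Fin B ↪ Fin n) (f : Fin K → Fin B) : Fin K ↪ Fin n where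
  toFun b := e (b, f b)
  inj' _ _ h := (Prod.ext_iff.1 (e.injective h)).1

lemma transversalEmb_apply {n K B : ℕ} (e : Fin K × Fin B ↪ Fin n) (f : Fin K → Fin B)
    (b : Fin K) : transversalEmb e f b = e (b, f b) := rfl

/-- The transversal of the array `e` picked out by `f`. -/
def transversal {n K B : ℕ} (e : Fin K × Fin B ↪ Fin n) (f : Fin K → Fin B) : Finset (Fin n) :=
  Finset.univ.map (transversalEmb e f)

lemma card_transversal {n K B : ℕ} (e : Fin K × Fin B ↪ Fin n) (f : Fin K → Fin B) :
    (transversal e f).card = K := by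
  simp [transversal]

lemma card_transversal_sdiff {n K B : ℕ} (e : Fin K × Fin B ↪ Fin n) (f g : Fin K → Fin B) :
    ((transversal e g \ transversal e f).card : ℝ) =
      K - (Finset.univ.filter fun b => f b = g b).card := by
  have h : transversal e g ∩ transversal e f =
      (Finset.univ.filter fun b => f b = g b).map (transversalEmb e f) := by
    ext i
    simp only [transversal, Finset.mem_inter, Finset.mem_map, Finset.mem_univ, true_and,
      transversalEmb_apply, Finset.mem_filter]
    constructor
    · rintro ⟨⟨b, hb⟩, ⟨b', hb'⟩⟩
      have := Prod.ext_iff.1 (e.injective (hb.trans hb'.symm))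
      obtain rfl : b = b' := this.1
      exact ⟨b, this.2.symm, hb'⟩
    · rintro ⟨b, hfg, hb⟩
      exact ⟨⟨b, by rw [← hfg]; exact hb⟩, ⟨b, hb⟩⟩
  have hc := Finset.card_inter_add_card_sdiff (transversal e g) (transversal e f)
  rw [h, Finset.card_map, card_transversal] at hc
  rw [eq_sub_iff_add_eq, add_comm]
  exact_mod_cast hc

lemma gaussVec_real_abs_sum_le {n : ℕ} (S : Finset (Fin n)) (d : ℝ) :
    (gaussVec n).real {v | |∑ i ∈ S, v i| ≤ d} =
      (gaussianReal 0 (S.card : ℝ≥0)).real {y | |y| ≤ d} := by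
  rw [← map_sum_gaussVec S, map_measureReal_apply (by fun_prop)
    (measurableSet_le (by fun_prop) measurable_const)]
  rfl

lemma measurableSet_abs_sum_le {n : ℕ} (S : Finset (Fin n)) (d : ℝ) :
    MeasurableSet {v : Fin n → ℝ | |∑ i ∈ S, v i| ≤ d} :=
  measurableSet_le (by fun_prop) measurable_const

lemma FEvent_eq_pi (m n : ℕ) (d : ℝ) (U : Finset (Fin n)) :
    FEvent m n d U = Set.univ.pi fun _ => {v : Fin n → ℝ | |∑ i ∈ U, v i| ≤ d}ᶜ := by
  ext v
  simp [FEvent]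

lemma measurableSet_FEvent (m n : ℕ) (d : ℝ) (U : Finset (Fin n)) :
    MeasurableSet (FEvent m n d U) := by
  rw [FEvent_eq_pi]
  exact MeasurableSet.univ_pi fun _ => (measurableSet_abs_sum_le U d).compl

lemma gaussMat_real_pi (m n : ℕ) (s : Set (Fin n → ℝ)) :
    (gaussMat m n).real (Set.univ.pi fun _ => s) = (gaussVec n).real s ^ m := by
  simp [gaussMat, measureReal_def, Measure.pi_pi, ENNReal.toReal_pow]

lemma gaussMat_real_FEvent (m n : ℕ) (d : ℝ) (U : Finset (Fin n)) :
    (gaussMat m n).real (FEvent m n d U) =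
      (1 - (gaussVec n).real {v | |∑ i ∈ U, v i| ≤ d}) ^ m := by
  rw [FEvent_eq_pi, gaussMat_real_pi, probReal_compl_eq_one_sub (measurableSet_abs_sum_le U d)]

lemma gaussMat_real_FEvent_inter (m n : ℕ) (d : ℝ) (U V : Finset (Fin n)) :
    (gaussMat m n).real (FEvent m n d U ∩ FEvent m n d V) =
      (1 - (gaussVec n).real {v | |∑ i ∈ U, v i| ≤ d}
        - (gaussVec n).real {v | |∑ i ∈ V, v i| ≤ d}
        + (gaussVec n).real ({v | |∑ i ∈ U, v i| ≤ d} ∩ {v | |∑ i ∈ V, v i| ≤ d})) ^ m := by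
  rw [FEvent_eq_pi, FEvent_eq_pi, ← Set.pi_inter_distrib, gaussMat_real_pi, ← Set.compl_union,
    probReal_compl_eq_one_sub ((measurableSet_abs_sum_le U d).union (measurableSet_abs_sum_le V d))]
  have := measureReal_union_add_inter (μ := gaussVec n) (s := {v | |∑ i ∈ U, v i| ≤ d})
    (measurableSet_abs_sum_le V d)
  congr 1
  linarith

lemma exp_le_one_add_two_mul {t : ℝ} (h0 : 0 ≤ t) (h1 : t ≤ 1) : Real.exp t ≤ 1 + 2 * t := by
  have := (abs_le.1 (Real.abs_exp_sub_one_sub_id_le (by rwa [abs_of_nonneg h0]))).2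
  nlinarith

lemma one_le_one_sub_mul_exp {p : ℝ} (h0 : 0 ≤ p) (h1 : p ≤ 1 / 2) :
    1 ≤ (1 - p) * Real.exp (2 * p) := by
  have := Real.add_one_le_exp (2 * p)
  nlinarith

lemma one_sub_two_mul_add_le {p q s : ℝ} (h1 : p ≤ 1 / 2) (hs : 0 ≤ s)
    (hq : q ≤ p ^ 2 * (1 + s)) :
    1 - p - p + q ≤ (1 - p) ^ 2 * Real.exp (4 * p ^ 2 * s) := by
  have h2 := Real.add_one_le_exp (4 * p ^ 2 * s)
  have h3 : (1 - p) ^ 2 * (4 * p ^ 2 * s + 1) ≤ (1 - p) ^ 2 * Real.exp (4 * p ^ 2 * s) := by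
    gcongr
  have h4 : 1 ≤ 4 * (1 - p) ^ 2 := by nlinarith
  have h5 : p ^ 2 * s * 1 ≤ p ^ 2 * s * (4 * (1 - p) ^ 2) := by gcongr
  nlinarith

lemma two_mul_div_sqrt_le {d K ℓ t : ℝ} (hd : 0 ≤ d) (hK : 0 < K) (hℓ : 0 ≤ ℓ)
    (hℓK : 2 * ℓ ≤ K) (ht0 : 0 ≤ t) (ht1 : t ≤ 1) :
    2 * d / √(2 * Real.pi * (K - ℓ)) ≤
      Real.exp (-t) * (2 * d / √(2 * Real.pi * K)) * (1 + (4 * t + 2 * (ℓ / K))) := by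
  have hKl : 0 < K - ℓ := by linarith
  set ρ := ℓ / K with hρ
  have hρ0 : 0 ≤ ρ := by positivity
  have hρ1 : ρ ≤ 1 / 2 := by rw [hρ, div_le_iff₀ hK]; linarith
  have hℓ' : ℓ = ρ * K := by rw [hρ]; field_simp
  have hsq : √K ≤ √(K - ℓ) * (1 + 2 * ρ) := by
    rw [← Real.sqrt_sq (by positivity : 0 ≤ 1 + 2 * ρ), ← Real.sqrt_mul hKl.le]
    refine Real.sqrt_le_sqrt ?_
    have h1 : 1 ≤ (1 - ρ) * (1 + 2 * ρ) := by nlinarith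
    have h2 : 1 ≤ (1 - ρ) * (1 + 2 * ρ) ^ 2 := by nlinarith
    calc K = K * 1 := by ring
      _ ≤ K * ((1 - ρ) * (1 + 2 * ρ) ^ 2) := by gcongr
      _ = _ := by rw [hℓ']; ring
  have hexp : 1 ≤ Real.exp (-t) * (1 + 2 * t) := by
    have := exp_le_one_add_two_mul ht0 ht1
    rw [Real.exp_neg, inv_mul_eq_div, le_div_iff₀ (Real.exp_pos t)]
    linarith
  have hmul : (1 + 2 * t) * (1 + 2 * ρ) ≤ 1 + (4 * t + 2 * ρ) := by nlinarith
  have h2π : 0 < √(2 * Real.pi) := by positivity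
  have hsK : 0 < √K := Real.sqrt_pos.2 hK
  have hsKl : 0 < √(K - ℓ) := Real.sqrt_pos.2 hKl
  rw [Real.sqrt_mul (by positivity) (K - ℓ), Real.sqrt_mul (by positivity) K]
  have hinv : 1 / √(K - ℓ) ≤ Real.exp (-t) * (1 / √K) * (1 + (4 * t + 2 * ρ)) := by
    rw [div_le_iff₀ hsKl]
    calc (1 : ℝ) ≤ Real.exp (-t) * (1 + 2 * t) := hexp
      _ = Real.exp (-t) * (1 + 2 * t) * (1 / √K) * √K := by field_simp
      _ ≤ Real.exp (-t) * (1 + 2 * t) * (1 / √K) * (√(K - ℓ) * (1 + 2 * ρ)) := by gcongr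
      _ = Real.exp (-t) * (1 / √K) * ((1 + 2 * t) * (1 + 2 * ρ)) * √(K - ℓ) := by ring
      _ ≤ _ := by gcongr
  calc 2 * d / (√(2 * Real.pi) * √(K - ℓ)) = 2 * d / √(2 * Real.pi) * (1 / √(K - ℓ)) := by
        field_simp
    _ ≤ 2 * d / √(2 * Real.pi) * (Real.exp (-t) * (1 / √K) * (1 + (4 * t + 2 * ρ))) := by gcongr
    _ = _ := by field_simp

/-- If `d` is small compared to `√K`, then with probability at least one half some transversal of a
`K × B` array of columns has all its `m` row sums larger than `d` in absolute value. -/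
lemma half_le_gaussMat_real_iUnion_FEvent {m n K B : ℕ} (hK : 0 < K) (hB : 0 < B)
    (e : Fin K × Fin B ↪ Fin n) {d P : ℝ} (hd : 0 ≤ d) (hP : P = d / √K) (hP1 : P ≤ 1 / 2)
    (h4 : 8 * m * P ^ 4 ≤ 1 / 16) (h2B : 16 * m * P ^ 2 / B ≤ 1 / 16) (h2K : 8 * m * P ^ 2 ≤ K)
    (hlog : 2 * m * P + K * Real.log 2 - K / 2 * Real.log B ≤ -3) :
    1 / 2 ≤ (gaussMat m n).real (⋃ f : Fin K → Fin B, FEvent m n d (transversal e f)) := by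
  have hK' : (0 : ℝ) < K := by exact_mod_cast hK
  have hB' : (0 : ℝ) < B := by exact_mod_cast hB
  have hB1 : (1 : ℝ) ≤ B := by exact_mod_cast hB
  have hKnn : ((K : ℝ≥0)) ≠ 0 := by exact_mod_cast hK.ne'
  have : Nonempty (Fin B) := ⟨⟨0, hB⟩⟩
  have hP0 : 0 ≤ P := by rw [hP]; positivity
  set p := (gaussianReal 0 (K : ℝ≥0)).real {y | |y| ≤ d} with hp
  have hpf : ∀ f, (gaussVec n).real {v | |∑ i ∈ transversal e f, v i| ≤ d} = p := by
    intro f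
    rw [gaussVec_real_abs_sum_le, card_transversal]
  have hp0 : 0 ≤ p := measureReal_nonneg
  have hpP : p ≤ P := by
    have h := gaussianReal_real_abs_add_le hKnn 0 hd
    simp only [zero_add] at h
    refine h.trans ?_
    rw [hP, NNReal.coe_natCast, Real.sqrt_mul (by positivity)]
    have : 2 ≤ √(2 * Real.pi) := Real.le_sqrt_of_sq_le (by nlinarith [Real.pi_gt_three])
    rw [div_le_div_iff₀ (by positivity) (by positivity)]
    have : 0 ≤ d * √K := by positivity
    nlinarith
  have hp1 : p ≤ 1 / 2 := hpP.trans hP1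
  set t := d ^ 2 / (2 * K) with ht
  have htP : t = P ^ 2 / 2 := by
    rw [ht, hP, div_pow, Real.sq_sqrt hK'.le]; field_simp
  have ht0 : 0 ≤ t := by positivity
  have ht1 : t ≤ 1 := by rw [htP]; nlinarith
  have hplow : Real.exp (-t) * (2 * d / √(2 * Real.pi * K)) ≤ p := by
    simpa [ht] using le_gaussianReal_real_abs_le hKnn hd
  set r := (1 - p) ^ m with hr
  have hrpos : 0 < r := pow_pos (by linarith) m
  set lam := 8 * m * p ^ 2 / K with hlam
  set a := 16 * m * p ^ 2 * t with ha
  have hlam0 : 0 ≤ lam := by positivity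
  have hlam1 : lam ≤ 1 := by
    rw [hlam, div_le_one hK']
    exact le_trans (by gcongr) h2K
  have hlamB : K * (2 * lam / B) ≤ 1 / 16 := by
    calc K * (2 * lam / B) = 16 * m * p ^ 2 / B := by rw [hlam]; field_simp; ring
      _ ≤ 16 * m * P ^ 2 / B := by gcongr
      _ ≤ _ := h2B
  have ha1 : a ≤ 1 / 16 := by
    calc a = 8 * m * p ^ 2 * P ^ 2 := by rw [ha, htP]; ring
      _ ≤ 8 * m * P ^ 2 * P ^ 2 := by gcongr
      _ = 8 * m * P ^ 4 := by ring
      _ ≤ _ := h4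
  have hpair : ∀ f g : Fin K → Fin B,
      (gaussMat m n).real (FEvent m n d (transversal e f) ∩ FEvent m n d (transversal e g)) ≤
        r ^ 2 * (Real.exp a * Real.exp lam ^ (Finset.univ.filter fun b => f b = g b).card +
          Real.exp (2 * m * p) / √B ^ K *
            (B : ℝ) ^ (Finset.univ.filter fun b => f b = g b).card) := by
    intro f g
    rw [gaussMat_real_FEvent_inter, hpf, hpf]
    set q := (gaussVec n).real ({v | |∑ i ∈ transversal e f, v i| ≤ d} ∩
      {v | |∑ i ∈ transversal e g, v i| ≤ d}) with hq
    set ℓ := (Finset.univ.filter fun b => f b = g b).card with hℓ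
    have hq0 : 0 ≤ q := measureReal_nonneg
    have hbase : 0 ≤ 1 - p - p + q := by linarith
    have hsd := card_transversal_sdiff e f g
    rw [← hℓ] at hsd
    by_cases hcase : 2 * ℓ ≤ K
    · have hcase' : 2 * (ℓ : ℝ) ≤ K := by exact_mod_cast hcase
      have hne : (transversal e g \ transversal e f).card ≠ 0 := by
        intro h0
        rw [h0] at hsd
        push_cast at hsd
        linarith
      have hqle : q ≤ p ^ 2 * (1 + (4 * t + 2 * (ℓ / K))) := by
        have h := gaussVec_real_inter_le (transversal e f) (transversal e g) hne hd
        rw [hpf, hsd] at h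
        calc q ≤ 2 * d / √(2 * Real.pi * (K - ℓ)) * p := h
          _ ≤ Real.exp (-t) * (2 * d / √(2 * Real.pi * K)) * (1 + (4 * t + 2 * (ℓ / K))) * p := by
              gcongr
              exact two_mul_div_sqrt_le hd hK' (by positivity) hcase' ht0 ht1
          _ ≤ p * (1 + (4 * t + 2 * (ℓ / K))) * p := by gcongr
          _ = _ := by ring
      have h1 := one_sub_two_mul_add_le hp1 (by positivity) hqle
      calc (1 - p - p + q) ^ m
          ≤ ((1 - p) ^ 2 * Real.exp (4 * p ^ 2 * (4 * t + 2 * (ℓ / K)))) ^ m := by gcongr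
        _ = r ^ 2 * (Real.exp a * Real.exp lam ^ ℓ) := by
            rw [mul_pow, ← Real.exp_nat_mul, ← Real.exp_nat_mul, ← Real.exp_add, hr, ← pow_mul,
              ← pow_mul, mul_comm 2 m, ha, hlam]
            congr 2
            field_simp
            ring
        _ ≤ _ := by
            gcongr
            exact le_add_of_nonneg_right (by positivity)
    · have hqp : q ≤ p := by
        rw [← hpf f]
        exact measureReal_mono Set.inter_subset_left
      have h1 : 1 - p - p + q ≤ (1 - p) ^ 2 * Real.exp (2 * p) := by
        have := one_le_one_sub_mul_exp hp0 hp1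
        nlinarith
      have hsB : 1 ≤ √(B : ℝ) := Real.one_le_sqrt.2 hB1
      have h2 : √(B : ℝ) ^ K ≤ (B : ℝ) ^ ℓ := by
        calc √(B : ℝ) ^ K ≤ √(B : ℝ) ^ (2 * ℓ) := pow_le_pow_right₀ hsB (by omega)
          _ = (B : ℝ) ^ ℓ := by rw [pow_mul, Real.sq_sqrt hB'.le]
      calc (1 - p - p + q) ^ m ≤ ((1 - p) ^ 2 * Real.exp (2 * p)) ^ m := by gcongr
        _ = r ^ 2 * (Real.exp (2 * m * p) / √B ^ K * √B ^ K) := by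
            rw [div_mul_cancel₀ _ (by positivity), mul_pow, ← Real.exp_nat_mul, hr, ← pow_mul,
              ← pow_mul, mul_comm 2 m]
            congr 2
            ring
        _ ≤ r ^ 2 * (Real.exp (2 * m * p) / √B ^ K * (B : ℝ) ^ ℓ) := by gcongr
        _ ≤ _ := by
            gcongr
            exact le_add_of_nonneg_left (by positivity)
  have hmgf : ((B : ℝ) - 1 + Real.exp lam) ^ K ≤ B ^ K * Real.exp (1 / 16) := by
    have h1 := exp_le_one_add_two_mul hlam0 hlam1
    calc ((B : ℝ) - 1 + Real.exp lam) ^ K ≤ (B * Real.exp (2 * lam / B)) ^ K := by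
          have h2 := Real.add_one_le_exp (2 * lam / B)
          have h3 : (B : ℝ) * (2 * lam / B + 1) ≤ B * Real.exp (2 * lam / B) := by gcongr
          have h4 : (B : ℝ) * (2 * lam / B + 1) = 2 * lam + B := by field_simp
          have h5 : 0 ≤ (B : ℝ) - 1 + Real.exp lam := by linarith [Real.exp_pos lam]
          gcongr
          linarith
      _ = B ^ K * Real.exp (K * (2 * lam / B)) := by rw [mul_pow, Real.exp_nat_mul]
      _ ≤ _ := by gcongr
  have hlarge : Real.exp (2 * m * p) / √B ^ K * ((B : ℝ) - 1 + B) ^ K ≤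
      B ^ K * Real.exp (-3) := by
    have hpow : ∀ x : ℝ, 0 < x → x ^ K = Real.exp (K * Real.log x) := fun x hx => by
      rw [Real.exp_nat_mul, Real.exp_log hx]
    calc Real.exp (2 * m * p) / √B ^ K * ((B : ℝ) - 1 + B) ^ K
        ≤ Real.exp (2 * m * P) / √B ^ K * (2 * B) ^ K := by
          have : 0 ≤ (B : ℝ) - 1 + B := by linarith
          gcongr
          linarith
      _ = B ^ K * (Real.exp (2 * m * P) * 2 ^ K / √B ^ K) := by rw [mul_pow]; ring
      _ = B ^ K * Real.exp (2 * m * P + K * Real.log 2 - K / 2 * Real.log B) := by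
          rw [hpow 2 (by norm_num), hpow _ (Real.sqrt_pos.2 hB'), Real.log_sqrt hB'.le,
            ← Real.exp_add, ← Real.exp_sub]
          congr 2
          ring
      _ ≤ _ := by gcongr
  have hnum : Real.exp (1 / 8) + Real.exp (-3) ≤ 1 + 1 / 2 := by
    have h1 := exp_le_one_add_two_mul (t := 1 / 8) (by norm_num) (by norm_num)
    have h2 : Real.exp (-3) ≤ 1 / 4 := by
      rw [Real.exp_neg, inv_le_comm₀ (Real.exp_pos _) (by norm_num)]
      linarith [Real.add_one_le_exp (3 : ℝ)]
    linarith
  have hmain := one_sub_le_measureReal_iUnion (μ := gaussMat m n) (δ := 1 / 2)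
    (F := fun f : Fin K → Fin B => FEvent m n d (transversal e f))
    (fun f => measurableSet_FEvent m n d _) hrpos
    (fun f => by rw [gaussMat_real_FEvent, hpf]) ?_
  · linarith
  · calc ∑ f : Fin K → Fin B, ∑ g : Fin K → Fin B,
          (gaussMat m n).real (FEvent m n d (transversal e f) ∩ FEvent m n d (transversal e g))
        ≤ ∑ f : Fin K → Fin B, ∑ g : Fin K → Fin B,
          r ^ 2 * (Real.exp a * Real.exp lam ^ (Finset.univ.filter fun b => f b = g b).card +
          Real.exp (2 * m * p) / √B ^ K *
            (B : ℝ) ^ (Finset.univ.filter fun b => f b = g b).card) :=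
          Finset.sum_le_sum fun f _ => Finset.sum_le_sum fun g _ => hpair f g
      _ = (B : ℝ) ^ K * (r ^ 2 * (Real.exp a * ((B : ℝ) - 1 + Real.exp lam) ^ K +
          Real.exp (2 * m * p) / √B ^ K * ((B : ℝ) - 1 + B) ^ K)) := by
          simp_rw [← Finset.mul_sum, Finset.sum_add_distrib, ← Finset.mul_sum, sum_pow_card_agree]
          simp
          ring
      _ ≤ (B : ℝ) ^ K * (r ^ 2 * (Real.exp (1 / 16) * (B ^ K * Real.exp (1 / 16)) +
          B ^ K * Real.exp (-3))) := by gcongr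
      _ = (Real.exp (1 / 8) + Real.exp (-3)) * ((B : ℝ) ^ K * r) ^ 2 := by
          have : Real.exp (1 / 8) = Real.exp (1 / 16) * Real.exp (1 / 16) := by
            rw [← Real.exp_add]; norm_num
          rw [this]; ring
      _ ≤ (1 + 1 / 2) * (Fintype.card (Fin K → Fin B) * r) ^ 2 := by
          simp only [Fintype.card_fun, Fintype.card_fin, Nat.cast_pow]
          gcongr

lemma sgn_eq_sgn_of_abs_lt {x y : ℝ} (h : |y| < |x|) : sgn x = sgn (x + y) := by
  unfold sgn
  rcases abs_lt.1 h with ⟨h1, h2⟩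
  rcases le_or_gt 0 x with hx | hx
  · rw [abs_of_nonneg hx] at h1
    rw [if_pos hx, if_pos (by linarith)]
  · rw [abs_of_neg hx] at h2
    rw [if_neg (by linarith), if_neg (by linarith)]

/-- If each row sum over `S`, scaled by `R`, dominates the entry in a fresh column `j`, then
`R · 1_S` and `R · 1_S + e_j` are indistinguishable. -/
lemma not_validMeas_of_abs_lt {m n k : ℕ} {R : ℝ} (hR : 1 ≤ R) {A : Fin m → Fin n → ℝ}
    {S : Finset (Fin n)} {j : Fin n} (hj : j ∉ S) (hS : S.card + 1 ≤ k)
    (h : ∀ i, |A i j| < R * |∑ s ∈ S, A i s|) : ¬ ValidMeas m n k R A := by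
  intro hvalid
  have hR0 : 0 < R := by linarith
  let u : Fin n → ℝ := fun i => if i ∈ S then R else 0
  let v : Fin n → ℝ := fun i => u i + if i = j then 1 else 0
  have hv : ∀ i, v i = if i = j then 1 else if i ∈ S then R else 0 := by
    intro i
    by_cases hij : i = j
    · simp [v, u, hij, hj]
    · simp [v, u, hij]
  have hu_mem : u ∈ sparseDR n k R := by
    refine ⟨?_, fun i i' hi hi' => ?_⟩
    · refine (Finset.card_le_card (t := S) fun i hi => ?_).trans (by omega)
      by_contra hiS
      simp [u, hiS] at hi
    · have hiS : i ∈ S := by by_contra hiS; simp [u, hiS] at hi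
      have hiS' : i' ∈ S := by by_contra hiS'; simp [u, hiS'] at hi'
      simp only [u, hiS, hiS', if_true, abs_of_pos hR0]
      nlinarith
  have hv_mem : v ∈ sparseDR n k R := by
    refine ⟨?_, fun i i' hi hi' => ?_⟩
    · refine (Finset.card_le_card (t := insert j S) fun i hi => ?_).trans
        ((Finset.card_insert_le _ _).trans hS)
      by_contra hiS
      rw [Finset.mem_insert, not_or] at hiS
      simp [hv, hiS] at hi
    · have hup : ∀ i, |v i| ≤ R := by
        intro i
        rw [hv]
        split_ifs
        · simpa using hR
        · rw [abs_of_pos hR0]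
        · simpa using hR0.le
      have hlo : 1 ≤ |v i'| := by
        rw [hv] at hi' ⊢
        split_ifs at hi' ⊢
        · simp
        · rwa [abs_of_pos hR0]
        · exact absurd rfl hi'
      nlinarith [hup i]
  refine hvalid u hu_mem v hv_mem (fun hsupp => ?_) (funext fun i => ?_)
  · have h1 : j ∈ Function.support v := by simp [hv]
    rw [← hsupp] at h1
    exact h1 (by simp [u, hj])
  · have hsu : ∑ s, A i s * u s = R * ∑ s ∈ S, A i s := by
      simp [u, Finset.mul_sum, mul_comm]
    have hsv : ∑ s, A i s * v s = R * ∑ s ∈ S, A i s + A i j := by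
      simp only [v, mul_add, Finset.sum_add_distrib, hsu]
      simp
    simp only [hsu, hsv]
    exact sgn_eq_sgn_of_abs_lt (by rw [abs_mul, abs_of_pos hR0]; exact h i)

/-- With high probability all entries of a fixed column of a Gaussian matrix are small. -/
lemma gaussMat_real_exists_lt_abs_le {m n : ℕ} (j : Fin n) {D : ℝ} (hD : 0 ≤ D) :
    (gaussMat m n).real {A | ∃ i, D < |A i j|} ≤ m * (2 * Real.exp (-(D ^ 2 / 2))) := by
  have hset : {A : Fin m → Fin n → ℝ | ∃ i, D < |A i j|} = ⋃ i, {A | D < |A i j|} := by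
    ext A; simp
  rw [hset]
  refine (measureReal_iUnion_fintype_le _).trans ?_
  have hi : ∀ i : Fin m, (gaussMat m n).real {A | D < |A i j|} ≤
      2 * Real.exp (-(D ^ 2 / 2)) := by
    intro i
    have hm : MeasurableSet {y : ℝ | D < |y|} := measurableSet_lt measurable_const (by fun_prop)
    have h1 : (gaussMat m n).map (fun A => A i j) = gaussianReal 0 1 := by
      have := (measurePreserving_eval (fun _ : Fin m => gaussVec n) i).map_eq
      rw [← map_eval_gaussVec j, ← this, Measure.map_map (by fun_prop) (by fun_prop)]
      rfl
    have h2 := gaussianReal_real_lt_abs_le hD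
    rw [← h1, map_measureReal_apply (by fun_prop) hm] at h2
    exact h2
  exact (Finset.sum_le_sum fun i _ => hi i).trans (by simp)

/-- The quantitative estimate behind the lower bound, with the size of `k` made explicit. -/
lemma one_third_le_gaussMat_real_iUnion_FEvent_diff {n k m K B : ℕ} (hkK : k = K + 1)
    (e : Fin K × Fin B ↪ Fin n) (j : Fin n) {L R : ℝ} (hL : L = Real.log k) (hL8 : 8 ≤ L)
    (hLk : 1024 * L ^ 4 ≤ √k) (hBk : 32 * L ^ 2 * √k ≤ B) (hR1 : 1 ≤ R) (hRk : R ≤ √k)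
    (hm : (m : ℝ) ≤ 1 / 512 * R * (k * √k * √L)) :
    1 / 3 ≤ (gaussMat m n).real
      ((⋃ f : Fin K → Fin B, FEvent m n (4 * √L / R) (transversal e f)) \
        {A | ∃ i, 4 * √L < |A i j|}) := by
  set s := √(k : ℝ) with hs
  set w := √L with hw
  set T := √(K : ℝ) with hT
  have hR0 : 0 < R := by linarith
  have hw2 : w ^ 2 = L := Real.sq_sqrt (by linarith)
  have hw0 : 0 < w := Real.sqrt_pos.2 (by linarith)
  have hwL : w ≤ L := by nlinarith
  have hs2 : s ^ 2 = k := Real.sq_sqrt (by positivity)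
  have hL1 : 1 ≤ L ^ 3 := one_le_pow₀ (by linarith)
  have hLs : 1024 * L ≤ s := by nlinarith
  have hs0 : 0 < s := by linarith
  have hsk : s ≤ k := by nlinarith
  have hk : (1024 : ℝ) ≤ k := by nlinarith
  have hkK' : (k : ℝ) = K + 1 := by exact_mod_cast hkK
  have hK4 : (4 : ℝ) ≤ K := by linarith
  have hT2 : T ^ 2 = K := Real.sq_sqrt (by positivity)
  have hT0 : 0 < T := Real.sqrt_pos.2 (by linarith)
  have hsT : s ≤ 2 * T := by
    refine abs_le_of_sq_le_sq' ?_ (by positivity) |>.2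
    nlinarith
  have hTs : T ≤ s := Real.sqrt_le_sqrt (by linarith)
  have hB0 : (0 : ℝ) < B := lt_of_lt_of_le (by positivity) hBk
  set P := 4 * w / R / T with hP
  have hP0 : 0 < P := by positivity
  have hPT : P ≤ 4 * L / T := by
    rw [hP]
    gcongr
    exact (div_le_self (by positivity) hR1).trans (by linarith)
  have hmP : m * P ≤ K * L / 32 := by
    calc m * P ≤ 1 / 512 * R * (k * s * w) * P := by gcongr
      _ = k * s * w ^ 2 / (128 * T) := by rw [hP]; field_simp; ring
      _ ≤ (2 * K) * (2 * T) * w ^ 2 / (128 * T) := by gcongr; linarith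
      _ = K * L / 32 := by rw [hw2]; field_simp; ring
  have hTL : 512 * L ^ 4 ≤ T := by linarith
  have hL2 : L ^ 2 ≤ L ^ 4 := pow_le_pow_right₀ (by linarith) (by norm_num)
  have hLL2 : L ≤ L ^ 2 := by nlinarith
  have hmP2 : m * P ^ 2 ≤ K * L ^ 2 / (8 * T) := by
    calc m * P ^ 2 = m * P * P := by ring
      _ ≤ K * L / 32 * (4 * L / T) := by gcongr
      _ = _ := by field_simp; ring
  have hhalf : 1 / 2 ≤ (gaussMat m n).real
      (⋃ f : Fin K → Fin B, FEvent m n (4 * w / R) (transversal e f)) := by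
    refine half_le_gaussMat_real_iUnion_FEvent (by exact_mod_cast (by linarith : (0 : ℝ) < K))
      (by exact_mod_cast hB0) e (by positivity) hP ?_ ?_ ?_ ?_ ?_
    · refine hPT.trans ?_
      rw [div_le_iff₀ hT0]
      linarith
    · calc 8 * m * P ^ 4 = 8 * (m * P ^ 2) * P ^ 2 := by ring
        _ ≤ 8 * (K * L ^ 2 / (8 * T)) * (4 * L / T) ^ 2 := by gcongr
        _ = 16 * L ^ 4 / T := by rw [← hT2]; field_simp; ring
        _ ≤ 1 / 16 := by
            rw [div_le_iff₀ hT0]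
            linarith
    · rw [div_le_iff₀ hB0]
      calc 16 * m * P ^ 2 = 16 * (m * P ^ 2) := by ring
        _ ≤ 16 * (K * L ^ 2 / (8 * T)) := by gcongr
        _ = 2 * L ^ 2 * T := by rw [← hT2]; field_simp; ring
        _ ≤ 2 * L ^ 2 * s := by gcongr
        _ ≤ _ := by linarith
    · calc 8 * m * P ^ 2 = 8 * (m * P ^ 2) := by ring
        _ ≤ 8 * (K * L ^ 2 / (8 * T)) := by gcongr
        _ = K * (L ^ 2 / T) := by field_simp
        _ ≤ K * 1 := by
            gcongr
            rw [div_le_one hT0]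
            linarith
        _ = K := mul_one _
    · have hlogB : L / 2 ≤ Real.log B := by
        rw [hL, ← Real.log_sqrt (by positivity)]
        refine Real.log_le_log hs0 (le_trans ?_ hBk)
        have : 1 ≤ 32 * L ^ 2 := by nlinarith
        exact le_mul_of_one_le_left hs0.le this
      have hlog2 : Real.log 2 ≤ 0.7 := by linarith [Real.log_two_lt_d9]
      have h1 : K * Real.log 2 ≤ K * 0.7 := by gcongr
      have h2 : (K : ℝ) / 2 * (L / 2) ≤ K / 2 * Real.log B := by gcongr
      have h3 : (K : ℝ) * 8 ≤ K * L := by gcongr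
      linarith
  have htail : (gaussMat m n).real {A | ∃ i, 4 * w < |A i j|} ≤ 1 / 10 := by
    refine (gaussMat_real_exists_lt_abs_le j (by positivity)).trans ?_
    have hexp : Real.exp (-((4 * w) ^ 2 / 2)) = ((k : ℝ) ^ 8)⁻¹ := by
      have h8 : (4 * w) ^ 2 / 2 = (8 : ℕ) * L := by rw [mul_pow, hw2]; push_cast; ring
      rw [h8, Real.exp_neg, Real.exp_nat_mul, hL, Real.exp_log (by linarith)]
    have hwk : w ≤ k := by linarith
    have hm3 : (m : ℝ) ≤ k ^ 3 := by
      calc (m : ℝ) ≤ 1 / 512 * R * (k * s * w) := hm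
        _ ≤ 1 * s * (k * s * k) := by gcongr; norm_num
        _ = s ^ 2 * k ^ 2 := by ring
        _ = k ^ 3 := by rw [hs2]; ring
    have hk4 : (1 : ℝ) ≤ (k : ℝ) ^ 4 := one_le_pow₀ (by linarith)
    rw [hexp]
    calc (m : ℝ) * (2 * ((k : ℝ) ^ 8)⁻¹) ≤ k ^ 3 * (2 * ((k : ℝ) ^ 8)⁻¹) := by gcongr
      _ = 2 / (k ^ 4 * k) := by field_simp
      _ ≤ 2 / (1 * 1024) := by gcongr
      _ ≤ 1 / 10 := by norm_num
  have hdiff := (measureReal_mono (μ := gaussMat m n) (Set.subset_sdiff_union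
    (⋃ f : Fin K → Fin B, FEvent m n (4 * w / R) (transversal e f))
    {A | ∃ i, 4 * w < |A i j|})).trans (measureReal_union_le _ _)
  linarith

lemma rpow_three_halves {x : ℝ} (hx : 0 ≤ x) : x ^ ((3 : ℝ) / 2) = x * √x := by
  rw [show (3 : ℝ) / 2 = 1 + 1 / 2 by norm_num, Real.rpow_add' hx (by norm_num), Real.rpow_one,
    Real.sqrt_eq_rpow]

lemma eventually_mul_log_rpow_le_rpow (C r : ℝ) {s : ℝ} (hs : 0 < s) (hC : 0 < C) :
    ∀ᶠ k : ℕ in Filter.atTop, C * Real.log k ^ r ≤ (k : ℝ) ^ s := by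
  have h := (isLittleO_log_rpow_rpow_atTop r hs).bound (inv_pos.2 hC)
  filter_upwards [tendsto_natCast_atTop_atTop.eventually h, Filter.eventually_ge_atTop 1]
    with k hk hk1
  have hlog : 0 ≤ Real.log k := Real.log_natCast_nonneg k
  rw [Real.norm_of_nonneg (Real.rpow_nonneg hlog r),
    Real.norm_of_nonneg (by positivity), inv_mul_eq_div, le_div_iff₀ hC] at hk
  linarith

/-- with `m < c·R·(k/log k)^{3/2}·min(R², (log k)²)` measurements, an i.i.d.
Gaussian matrix fails to be a valid universal 1-bit measurement matrix for support
recovery on `X_k(R)` with probability at least `1/3`. -/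
theorem gaussian_lower_bound (ε : ℝ) (hε1 : 0 < ε) (hε2 : ε < 2/3) :
    ∃ c : ℝ, 0 < c ∧ ∃ N : ℕ, ∀ n k m : ℕ, N ≤ n → N ≤ k →
      (k : ℝ) ≤ (n : ℝ) ^ ((2:ℝ)/3 - ε) →
      ∀ R : ℝ, 1 ≤ R → R ≤ min ((n : ℝ) ^ (0.5 * ε)) ((k : ℝ) ^ (0.5 - ε)) →
      (m : ℝ) < c * R * ((k : ℝ) / Real.log k) ^ ((3:ℝ)/2) * min (R ^ 2) ((Real.log k) ^ 2) →
      gaussMat m n {A | ¬ ValidMeas m n k R A} ≥ 1/3 := by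
  refine ⟨1 / 512, by norm_num, ?_⟩
  have hev := (eventually_mul_log_rpow_le_rpow 1024 4 (s := 1 / 2) (by norm_num)
    (by norm_num)).and ((eventually_mul_log_rpow_le_rpow 64 2 (s := 2 * ε) (by linarith)
    (by norm_num)).and (((Real.tendsto_log_atTop.comp
      tendsto_natCast_atTop_atTop).eventually_ge_atTop (8 : ℝ)).and
      (Filter.eventually_ge_atTop (2 : ℕ))))
  obtain ⟨N, hN⟩ := Filter.eventually_atTop.1 hev
  refine ⟨N + 1, fun n k m hn hk hkn R hR1 hR hm => ?_⟩
  obtain ⟨hLk, hLε, hL8, hk2⟩ := hN k (by omega)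
  set L := Real.log k with hL
  have hL8 : 8 ≤ L := hL8
  have hL0 : 0 < L := by linarith
  have hk1 : (1 : ℝ) ≤ k := by exact_mod_cast (by omega : 1 ≤ k)
  have hk0 : (0 : ℝ) < k := by linarith
  rw [← Real.sqrt_eq_rpow] at hLk
  have hLk : 1024 * L ^ 4 ≤ √(k : ℝ) := by exact_mod_cast hLk
  have hLε : 64 * L ^ 2 ≤ (k : ℝ) ^ (2 * ε) := by exact_mod_cast hLε
  have hRk : R ≤ √(k : ℝ) := by
    rw [Real.sqrt_eq_rpow]
    refine (hR.trans (min_le_right _ _)).trans (Real.rpow_le_rpow_of_exponent_le hk1 ?_)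
    norm_num
    linarith
  have hm' : (m : ℝ) ≤ 1 / 512 * R * (k * √k * √L) := by
    calc (m : ℝ) ≤ 1 / 512 * R * ((k : ℝ) / L) ^ ((3:ℝ)/2) * min (R ^ 2) (L ^ 2) := hm.le
      _ ≤ 1 / 512 * R * ((k : ℝ) / L) ^ ((3:ℝ)/2) * L ^ 2 := by
          gcongr
          exact min_le_right _ _
      _ = 1 / 512 * R * (k * √k * √L) := by
          rw [rpow_three_halves (by positivity), Real.sqrt_div hk0.le]
          have hsL : 0 < √L := Real.sqrt_pos.2 hL0
          have hsq : √L ^ 2 = L := Real.sq_sqrt hL0.le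
          field_simp
          rw [hsq]
  have hnk : (k : ℝ) * (√k * (k : ℝ) ^ (2 * ε)) ≤ n := by
    have hn1 : (1 : ℝ) ≤ n := by exact_mod_cast (by omega : 1 ≤ n)
    calc (k : ℝ) * (√k * (k : ℝ) ^ (2 * ε)) = (k : ℝ) ^ (3 / 2 + 2 * ε) := by
          rw [Real.rpow_add hk0, rpow_three_halves hk0.le]; ring
      _ ≤ ((n : ℝ) ^ ((2:ℝ)/3 - ε)) ^ (3 / 2 + 2 * ε) := by gcongr
      _ = (n : ℝ) ^ (((2:ℝ)/3 - ε) * (3 / 2 + 2 * ε)) := by rw [Real.rpow_mul (by positivity)]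
      _ ≤ (n : ℝ) ^ (1 : ℝ) := Real.rpow_le_rpow_of_exponent_le hn1 (by nlinarith)
      _ = n := Real.rpow_one _
  obtain ⟨K, rfl⟩ : ∃ K, k = K + 1 := ⟨k - 1, by omega⟩
  have hK : 0 < K := by omega
  set B := (n - 1) / K with hB
  have hKB : K * B < n := by
    have := Nat.mul_div_le (n - 1) K
    rw [← hB] at this
    omega
  have hBk : 32 * L ^ 2 * √((K + 1 : ℕ) : ℝ) ≤ B := by
    set s := √((K + 1 : ℕ) : ℝ)
    have h1 : n ≤ K * (B + 1) := by
      have := Nat.lt_mul_div_succ (n - 1) hK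
      rw [← hB] at this
      omega
    have h2 : (n : ℝ) ≤ ((K + 1 : ℕ) : ℝ) * (B + 1) := by
      calc (n : ℝ) ≤ K * (B + 1) := by exact_mod_cast h1
        _ ≤ _ := by gcongr; linarith
    have h3 : s * ((K + 1 : ℕ) : ℝ) ^ (2 * ε) ≤ B + 1 :=
      le_of_mul_le_mul_left (hnk.trans h2) hk0
    have hs1 : 1 ≤ s := Real.one_le_sqrt.2 hk1
    have h4 : s * (64 * L ^ 2) ≤ s * ((K + 1 : ℕ) : ℝ) ^ (2 * ε) := by gcongr
    nlinarith [mul_le_mul hs1 (by nlinarith : 1 ≤ L ^ 2) zero_le_one (by linarith)]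
  let e : Fin K × Fin B ↪ Fin n := finProdFinEquiv.toEmbedding.trans (Fin.castLEEmb hKB.le)
  have hmain := one_third_le_gaussMat_real_iUnion_FEvent_diff rfl e ⟨K * B, hKB⟩ hL hL8 hLk hBk
    hR1 hRk hm'
  have hsub : (⋃ f : Fin K → Fin B, FEvent m n (4 * √L / R) (transversal e f)) \
      {A | ∃ i, 4 * √L < |A i ⟨K * B, hKB⟩|} ⊆ {A | ¬ ValidMeas m n (K + 1) R A} := by
    rintro A ⟨hA, hcol⟩
    obtain ⟨f, hf⟩ := Set.mem_iUnion.1 hA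
    simp only [Set.mem_ofPred_eq, not_exists, not_lt] at hcol
    refine not_validMeas_of_abs_lt hR1 (S := transversal e f) (j := ⟨K * B, hKB⟩) ?_ ?_ fun i => ?_
    · simp only [transversal, Finset.mem_map, transversalEmb_apply, not_exists, not_and]
      intro b _ hb
      have := congrArg Fin.val hb
      simp only [e, Function.Embedding.trans_apply, Equiv.coe_toEmbedding, Fin.castLEEmb_apply,
        Fin.val_castLE] at this
      exact absurd this (finProdFinEquiv (b, f b)).isLt.ne
    · rw [card_transversal]
    · have h1 : 4 * √L / R < |∑ s ∈ transversal e f, A i s| := hf i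
      rw [div_lt_iff₀ (by linarith)] at h1
      linarith [hcol i]
  refine le_trans ?_ (measure_mono hsub)
  rw [← ofReal_measureReal]
  calc (1 / 3 : ℝ≥0∞) = ENNReal.ofReal (1 / 3) := by
        rw [ENNReal.ofReal_div_of_pos (by norm_num)]; simp
    _ ≤ _ := ENNReal.ofReal_le_ofReal hmain
end

section
/- Let n ≥ 2, 2 ≤ k ≤ n − 1, R ≥ 1, and m ≥ 2. If A = (a_{i,j}) ∈ ℝ^(m×n) is a valid universal 1-bit measurement matrix for support recovery on X_k(R), then either the set V = {(a_{i,1}, a_{i,2}, …, a_{i,n−2}) : i ∈ {1,…,m}} ⊆ ℝ^(n−2) is (n−2, k−1, √(4 log m)/R)-balanced, or there exist indices i ∈ {1,…,m} and j ∈ {n−1, n} such that |a_{i,j}| > √(4 log m). -/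
open MeasureTheory ProbabilityTheory
open scoped NNReal ENNReal

/-- The vector equal to `1` at `p`, to `R` on the rest of `T`, and to `0` elsewhere. -/
noncomputable def spikeVec {n : ℕ} (R : ℝ) (T : Finset (Fin n)) (p : Fin n) : Fin n → ℝ :=
  fun j => if j = p then 1 else if j ∈ T then R else 0

lemma spikeVec_mem_sparseDR {n k : ℕ} {R : ℝ} (hR : 1 ≤ R) {T : Finset (Fin n)} {p : Fin n}
    (hT : T.card + 1 ≤ k) : spikeVec R T p ∈ sparseDR n k R := by
  refine ⟨le_trans (Finset.card_le_card (t := insert p T) fun j hj => ?_)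
    ((Finset.card_insert_le p T).trans hT), fun i j hi hj => ?_⟩
  · simp only [spikeVec] at hj
    grind
  · have hR0 : |R| = R := abs_of_nonneg (by linarith)
    simp only [spikeVec] at hi hj ⊢
    split_ifs at hi hj ⊢ <;> try contradiction
    all_goals
      simp only [abs_one, hR0]
      nlinarith

lemma sum_mul_spikeVec {n : ℕ} {R : ℝ} {T : Finset (Fin n)} {p : Fin n} (hp : p ∉ T)
    (a : Fin n → ℝ) : ∑ j, a j * spikeVec R T p j = R * ∑ j ∈ T, a j + a p := by
  have h : ∀ j, a j * spikeVec R T p j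
      = R * (if j ∈ T then a j else 0) + if j = p then a j else 0 := by
    intro j
    simp only [spikeVec]
    split_ifs with h1 h2
    · exact absurd (h1 ▸ h2) hp
    all_goals ring
  simp [h, Finset.sum_add_distrib, ← Finset.mul_sum]

lemma support_spikeVec_ne {n : ℕ} {R : ℝ} {T : Finset (Fin n)} {p q : Fin n}
    (hp : p ∉ T) (hpq : p ≠ q) :
    Function.support (spikeVec R T p) ≠ Function.support (spikeVec R T q) := by
  intro h
  have hmem : p ∈ Function.support (spikeVec R T p) := by simp [spikeVec]
  rw [h] at hmem
  simp [spikeVec, hp, hpq] at hmem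

/-- Adding a term of smaller magnitude does not change the sign. -/
lemma sgn_add_eq_of_abs_lt {x y : ℝ} (h : |y| < |x|) : sgn (x + y) = sgn x := by
  unfold sgn
  rcases abs_cases x with hx | hx <;> rcases abs_cases y with hy | hy <;>
    split_ifs <;> first | rfl | linarith

/-- if `A` is a valid universal 1-bit measurement matrix for support recovery
on `X_k(R)`, then either the rows truncated to the first `n-2` coordinates form an
`(n-2, k-1, √(4 log m)/R)`-balanced set, or some entry in the last two columns of `A`
exceeds `√(4 log m)` in absolute value. -/
theorem valid_implies_balanced_or_large_entry (n k m : ℕ) (hn : 2 ≤ n) (hk2 : 2 ≤ k)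
    (hkn : k ≤ n - 1) (R : ℝ) (hR : 1 ≤ R) (hm : 2 ≤ m)
    (A : Fin m → Fin n → ℝ) (hA : ValidMeas m n k R A) :
    IsBalanced (n - 2) (k - 1) (Real.sqrt (4 * Real.log m) / R)
      {w | ∃ i : Fin m, w = fun j : Fin (n - 2) => A i (Fin.castLE (by omega) j)} ∨
    ∃ i : Fin m, ∃ j : Fin n, (j.val = n - 2 ∨ j.val = n - 1) ∧
      Real.sqrt (4 * Real.log m) < |A i j| := by
  by_contra! hcon
  obtain ⟨hbal, hsmall⟩ := hcon
  simp only [IsBalanced, not_forall, not_exists, not_and, not_le] at hbal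
  obtain ⟨S, hS, hbig⟩ := hbal
  have hle : n - 2 ≤ n := Nat.sub_le n 2
  set T : Finset (Fin n) := S.map (Fin.castLEEmb hle) with hTdef
  have hT : T.card + 1 ≤ k := by
    rw [hTdef, Finset.card_map, hS]
    omega
  have hlast : ∀ p : Fin n, n - 2 ≤ p.val → p ∉ T := by
    intro p hp hpT
    obtain ⟨j, -, rfl⟩ := Finset.mem_map.mp hpT
    simp only [Fin.castLEEmb_apply, Fin.val_castLE] at hp
    omega
  have hsgn : ∀ p : Fin n, (p.val = n - 2 ∨ p.val = n - 1) → ∀ i,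
      sgn (∑ j, A i j * spikeVec R T p j) = sgn (R * ∑ j ∈ T, A i j) := by
    intro p hp i
    rw [sum_mul_spikeVec (hlast p (by omega))]
    refine sgn_add_eq_of_abs_lt ((hsmall i p hp).trans_lt ?_)
    have h := hbig _ ⟨i, rfl⟩
    have hR0 : 0 < R := by linarith
    rw [div_lt_iff₀ hR0] at h
    rw [abs_mul, abs_of_pos hR0, mul_comm R, hTdef, Finset.sum_map]
    exact h
  let p : Fin n := ⟨n - 2, by omega⟩
  let q : Fin n := ⟨n - 1, by omega⟩
  have hpq : p ≠ q := by
    simp only [p, q, ne_eq, Fin.mk.injEq]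
    omega
  refine hA _ (spikeVec_mem_sparseDR hR hT) _ (spikeVec_mem_sparseDR hR hT)
    (support_spikeVec_ne (hlast p le_rfl) hpq) (funext fun i => ?_)
  rw [hsgn p (Or.inl rfl) i, hsgn q (Or.inr rfl) i]
end
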